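/- Fix 0 < R ≤ 1/3 and set Λ(R) := inf_{a ∈ [0,1)} ((1−R²)/R²) · ((1−a⁴R²)/((1−a)(1+a)²)) · ((1−R(1+2a))/(1−aR)). Then for every f ∈ 𝓑 with Taylor coefficients a_n and every 0 ≤ r ≤ R one has Σ_{n=0}^∞ |a_n| r^n + Λ(R)·S_r(f)/(π − S_r(f)) ≤ 1, and this constant is sharp: no λ > Λ(R) satisfies this inequality for all f ∈ 𝓑 and all 0 ≤ r ≤ R. -/

import Mathlib

open Metric

/-- The `n`-th Taylor coefficient of `f` at `0`. -/
noncomputable def taylorCoeff (f : ℂ → ℂ) (n : ℕ) : ℂ :=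
  iteratedDeriv n f 0 / n.factorial

/-- The class `𝓑` of holomorphic functions on the unit disc bounded by `1`. -/
def memB (f : ℂ → ℂ) : Prop :=
  DifferentiableOn ℂ f (ball (0 : ℂ) 1) ∧ ∀ z ∈ ball (0 : ℂ) 1, ‖f z‖ ≤ 1

/-- `Σ_{n≥0} |aₙ| rⁿ`, the Bohr sum of `f` at radius `r`. -/
noncomputable def bohrSum (f : ℂ → ℂ) (r : ℝ) : ℝ :=
  ∑' n : ℕ, ‖taylorCoeff f n‖ * r ^ n

/-- `S_r(f) = π Σ_{n≥1} n |aₙ|² r^{2n}` (the `n = 0` term vanishes, so we may sum over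
all of `ℕ`). -/
noncomputable def Sarea (f : ℂ → ℂ) (r : ℝ) : ℝ :=
  Real.pi * ∑' n : ℕ, (n : ℝ) * ‖taylorCoeff f n‖ ^ 2 * r ^ (2 * n)

/-- `φ₀(f,r) = S_r(f)/(π − S_r(f))`. -/
noncomputable def phi0 (f : ℂ → ℂ) (r : ℝ) : ℝ :=
  Sarea f r / (Real.pi - Sarea f r)

/-- The explicit sharp constant
`Λ(R) = inf_{a ∈ [0,1)} ((1−R²)/R²) ((1−a⁴R²)/((1−a)(1+a)²)) ((1−R(1+2a))/(1−aR))`. -/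
noncomputable def LamExpr (R : ℝ) : ℝ :=
  sInf {x : ℝ | ∃ a : ℝ, 0 ≤ a ∧ a < 1 ∧
    x = (1 - R ^ 2) / R ^ 2 * ((1 - a ^ 4 * R ^ 2) / ((1 - a) * (1 + a) ^ 2)) *
      ((1 - R * (1 + 2 * a)) / (1 - a * R))}


/-- `F` is given on the unit disc by the power series with coefficients `c`. -/
def IsPS (c : ℕ → ℂ) (F : ℂ → ℂ) : Prop :=
  ∀ z : ℂ, ‖z‖ < 1 → HasSum (fun k => c k * z ^ k) (F z)

lemma isPS_of_diff {f : ℂ → ℂ} (hf : DifferentiableOn ℂ f (ball (0 : ℂ) 1)) :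
    IsPS (taylorCoeff f) f := by
  intro z hz
  have h := Complex.hasSum_taylorSeries_on_ball hf (z := z) (by simpa using hz)
  refine h.congr_fun ?_
  intro n
  simp only [taylorCoeff, smul_eq_mul, sub_zero]
  ring

lemma IsPS.unique {c d : ℕ → ℂ} {F : ℂ → ℂ} (hc : IsPS c F) (hd : IsPS d F) : c = d := by
  have key : ∀ e : ℕ → ℂ, IsPS e F →
      HasFPowerSeriesAt F (FormalMultilinearSeries.ofScalars ℂ e) 0 := by
    intro e he
    rw [hasFPowerSeriesAt_iff]
    filter_upwards [Metric.ball_mem_nhds (0 : ℂ) one_pos] with z hz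
    have := he z (by simpa using hz)
    simpa [FormalMultilinearSeries.coeff_ofScalars, mul_comm] using this
  have h := (key c hc).eq_formalMultilinearSeries (key d hd)
  funext n
  have := congrArg (fun p => FormalMultilinearSeries.coeff p n) h
  simpa [FormalMultilinearSeries.coeff_ofScalars] using this

lemma IsPS.mul {c d : ℕ → ℂ} {F G : ℂ → ℂ} (hc : IsPS c F) (hd : IsPS d G) :
    IsPS (fun n => ∑ kl ∈ Finset.HasAntidiagonal.antidiagonal n, c kl.1 * d kl.2) (fun z => F z * G z) := by
  intro z hz
  have h1 := (hc z hz).summable.norm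
  have h2 := (hd z hz).summable.norm
  have h3 := (summable_norm_sum_mul_antidiagonal_of_summable_norm h1 h2).of_norm.hasSum
  rw [← tsum_mul_tsum_eq_tsum_sum_antidiagonal_of_summable_norm h1 h2,
    (hc z hz).tsum_eq, (hd z hz).tsum_eq] at h3
  refine h3.congr_fun ?_
  intro n
  rw [Finset.sum_mul]
  refine Finset.sum_congr rfl fun kl hkl => ?_
  rw [← Finset.HasAntidiagonal.mem_antidiagonal.mp hkl, pow_add]
  ring

lemma fourier_nat_eq (k : ℕ) (x : AddCircle (1 : ℝ)) :
    fourier (k : ℤ) x = (fourier 1 x) ^ k := by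
  induction k with
  | zero => simp
  | succ k ih =>
    push_cast
    rw [fourier_add, ih, pow_succ]

lemma norm_fourier_one (x : AddCircle (1 : ℝ)) : ‖(fourier 1 x : ℂ)‖ = 1 := by
  rw [fourier_one]; exact Circle.norm_coe _

lemma L2_aux {d q : ℕ → ℂ} {F : ℂ → ℂ} (n N : ℕ) (hF : IsPS d F)
    (hle : ∀ z : ℂ, ‖z‖ < 1 → ‖F z‖ ≤ ‖∑ j ∈ Finset.range n, q j * z ^ j‖)
    (ρ : ℝ) (h0 : 0 ≤ ρ) (h1 : ρ < 1) :
    ∑ k ∈ Finset.range N, ‖d k‖ ^ 2 * (ρ ^ k) ^ 2 ≤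
      ∑ k ∈ Finset.range n, ‖q k‖ ^ 2 * (ρ ^ k) ^ 2 := by
  have hρ : ‖(ρ : ℂ)‖ < 1 := by simpa [abs_of_nonneg h0] using h1
  let v : ℕ → MeasureTheory.Lp ℂ 2 (@AddCircle.haarAddCircle (1 : ℝ) _) :=
    fun k => fourierLp 2 (k : ℤ)
  have hv : Orthonormal ℂ v :=
    (orthonormal_fourier (T := (1 : ℝ))).comp (fun k : ℕ => (k : ℤ)) Nat.cast_injective
  have hs : Summable (fun k : ℕ => (d k * (ρ : ℂ) ^ k) • (fourier (k : ℤ) : C(AddCircle (1 : ℝ), ℂ))) := by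
    apply Summable.of_norm
    have := (hF _ hρ).summable.norm
    refine this.congr fun k => ?_
    rw [norm_smul, fourier_norm, mul_one]
  obtain ⟨G, hG⟩ := hs
  let P : C(AddCircle (1 : ℝ), ℂ) :=
    ∑ k ∈ Finset.range n, (q k * (ρ : ℂ) ^ k) • (fourier (k : ℤ) : C(AddCircle (1 : ℝ), ℂ))
  let L := ContinuousMap.toLp (E := ℂ) 2 (@AddCircle.haarAddCircle (1 : ℝ) _) ℂ
  have hGx : ∀ x, G x = F (ρ * fourier 1 x) := by
    intro x
    have h2 : HasSum (fun k : ℕ => (d k * (ρ : ℂ) ^ k) • (fourier (k : ℤ) x : ℂ)) (G x) := by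
      have := hG.map (ContinuousMap.evalCLM ℂ x : C(AddCircle (1 : ℝ), ℂ) →L[ℂ] ℂ)
        (ContinuousMap.evalCLM ℂ x : C(AddCircle (1 : ℝ), ℂ) →L[ℂ] ℂ).continuous
      simpa [Function.comp_def] using this
    refine h2.unique ?_
    have h3 := hF (ρ * fourier 1 x) (by rw [norm_mul, norm_fourier_one, mul_one]; exact hρ)
    convert h3 using 2 with k
    rw [fourier_nat_eq, smul_eq_mul, mul_pow, mul_assoc]
  have hPx : ∀ x, P x = ∑ j ∈ Finset.range n, q j * (ρ * fourier 1 x) ^ j := by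
    intro x
    simp only [P, ContinuousMap.coe_sum, Finset.sum_apply, ContinuousMap.coe_smul, Pi.smul_apply]
    refine Finset.sum_congr rfl fun k _ => ?_
    rw [fourier_nat_eq, smul_eq_mul, mul_pow, mul_assoc]
  have hnorm : ‖L G‖ ≤ ‖L P‖ := by
    apply MeasureTheory.Lp.norm_le_norm_of_ae_le
    filter_upwards [ContinuousMap.coeFn_toLp (p := 2) (𝕜 := ℂ) (@AddCircle.haarAddCircle (1 : ℝ) _) G,
      ContinuousMap.coeFn_toLp (p := 2) (𝕜 := ℂ) (@AddCircle.haarAddCircle (1 : ℝ) _) P] with x hx hx'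
    rw [hx, hx', hGx, hPx]
    exact hle _ (by rw [norm_mul, norm_fourier_one, mul_one]; exact hρ)
  have hLG : HasSum (fun k : ℕ => (d k * (ρ : ℂ) ^ k) • v k) (L G) := by
    have := hG.map L L.continuous
    simpa [Function.comp_def, v, fourierLp] using this
  have hinner : ∀ m, inner ℂ (v m) (L G) = d m * (ρ : ℂ) ^ m := by
    intro m
    have h4 : HasSum (fun k : ℕ => inner ℂ (v m) ((d k * (ρ : ℂ) ^ k) • v k))
        (inner ℂ (v m) (L G)) := hLG.mapL (innerSL ℂ (v m))
    refine h4.unique ?_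
    have : d m * (ρ : ℂ) ^ m = inner ℂ (v m) ((d m * (ρ : ℂ) ^ m) • v m) := by
      rw [inner_smul_right, orthonormal_iff_ite.mp hv]; simp
    rw [this]
    refine hasSum_single m fun k hk => ?_
    rw [inner_smul_right, orthonormal_iff_ite.mp hv]; simp [hk.symm]
  have hLP : L P = ∑ k ∈ Finset.range n, (q k * (ρ : ℂ) ^ k) • v k := by
    simp [P, L, v, fourierLp]
  have hPn : ‖L P‖ ^ 2 = ∑ k ∈ Finset.range n, ‖q k * (ρ : ℂ) ^ k‖ ^ 2 := by
    have h5 := hv.inner_sum (fun k => q k * (ρ : ℂ) ^ k) (fun k => q k * (ρ : ℂ) ^ k)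
      (Finset.range n)
    rw [← hLP, inner_self_eq_norm_sq_to_K] at h5
    have : ((‖L P‖ ^ 2 : ℝ) : ℂ) = ((∑ k ∈ Finset.range n, ‖q k * (ρ : ℂ) ^ k‖ ^ 2 : ℝ) : ℂ) := by
      push_cast
      rw [show ((‖L P‖ : ℂ) ^ 2) = _ from h5]
      refine Finset.sum_congr rfl fun k _ => ?_
      rw [mul_comm, RCLike.mul_conj]
      simp
    exact_mod_cast this
  have hB := hv.sum_inner_products_le (L G) (s := Finset.range N)
  have hsq : ∀ (e : ℂ) (k : ℕ), ‖e * (ρ : ℂ) ^ k‖ ^ 2 = ‖e‖ ^ 2 * (ρ ^ k) ^ 2 := by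
    intro e k
    rw [norm_mul, norm_pow, mul_pow, Complex.norm_real, Real.norm_of_nonneg h0]
  simp only [hinner, hsq] at hB
  simp only [hsq] at hPn
  rw [← hPn]
  exact hB.trans (by gcongr)

lemma L2_bound {d q : ℕ → ℂ} {F : ℂ → ℂ} (n N : ℕ) (hF : IsPS d F)
    (hle : ∀ z : ℂ, ‖z‖ < 1 → ‖F z‖ ≤ ‖∑ j ∈ Finset.range n, q j * z ^ j‖) :
    ∑ k ∈ Finset.range N, ‖d k‖ ^ 2 ≤ ∑ k ∈ Finset.range n, ‖q k‖ ^ 2 := by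
  have key : ∀ (e : ℕ → ℂ) (M : ℕ), Filter.Tendsto
      (fun ρ : ℝ => ∑ k ∈ Finset.range M, ‖e k‖ ^ 2 * (ρ ^ k) ^ 2) (nhdsWithin 1 (Set.Iio 1))
      (nhds (∑ k ∈ Finset.range M, ‖e k‖ ^ 2)) := by
    intro e M
    have hc : Continuous (fun ρ : ℝ => ∑ k ∈ Finset.range M, ‖e k‖ ^ 2 * (ρ ^ k) ^ 2) := by
      fun_prop
    have := (hc.tendsto 1).mono_left (nhdsWithin_le_nhds (s := Set.Iio 1))
    simpa using this
  refine le_of_tendsto_of_tendsto (key d N) (key q n) ?_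
  filter_upwards [Ioo_mem_nhdsLT (show (0 : ℝ) < 1 by norm_num)] with ρ hρ
  exact L2_aux n N hF hle ρ hρ.1.le hρ.2

lemma mobius_norm {α w : ℂ} (hα : ‖α‖ ≤ 1) (hw : ‖w‖ ≤ 1) :
    ‖w - α‖ ≤ ‖1 - (starRingEnd ℂ) α * w‖ := by
  have h1 : α.re ^ 2 + α.im ^ 2 ≤ 1 := by
    have := Complex.sq_norm α
    rw [Complex.normSq_apply] at this
    nlinarith [norm_nonneg α]
  have h2 : w.re ^ 2 + w.im ^ 2 ≤ 1 := by
    have := Complex.sq_norm w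
    rw [Complex.normSq_apply] at this
    nlinarith [norm_nonneg w]
  have h3 : ‖w - α‖ ^ 2 ≤ ‖1 - (starRingEnd ℂ) α * w‖ ^ 2 := by
    rw [Complex.sq_norm, Complex.sq_norm, Complex.normSq_apply, Complex.normSq_apply]
    simp
    nlinarith [mul_nonneg (sub_nonneg.mpr h1) (sub_nonneg.mpr h2)]
  exact le_of_sq_le_sq h3 (norm_nonneg _)

lemma taylorCoeff_zero (f : ℂ → ℂ) : taylorCoeff f 0 = f 0 := by
  simp [taylorCoeff]

lemma coeff_rec {f : ℂ → ℂ} (hf : memB f) (h1 : ‖taylorCoeff f 0‖ < 1) (m : ℕ) :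
    ∑ k ∈ Finset.range (m + 1), ‖taylorCoeff f (k + 1)‖ ^ 2 ≤
      (1 - ‖taylorCoeff f 0‖ ^ 2) ^ 2 +
        ‖taylorCoeff f 0‖ ^ 2 * ∑ k ∈ Finset.range m, ‖taylorCoeff f (k + 1)‖ ^ 2 := by
  obtain ⟨hd, hb⟩ := hf
  have hps := isPS_of_diff hd
  set a := taylorCoeff f with ha
  set α := a 0 with hα
  have hf0 : f 0 = α := (taylorCoeff_zero f).symm
  have hden : ∀ z ∈ ball (0 : ℂ) 1, 1 - (starRingEnd ℂ) α * f z ≠ 0 := by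
    intro z hz h
    have h2 : (starRingEnd ℂ) α * f z = 1 := (sub_eq_zero.mp h).symm
    have h3 : ‖(starRingEnd ℂ) α * f z‖ < 1 := by
      rw [norm_mul, RCLike.norm_conj]
      nlinarith [hb z hz, norm_nonneg α, norm_nonneg (f z)]
    rw [h2] at h3
    simp at h3
  let g : ℂ → ℂ := fun z => (f z - α) / (1 - (starRingEnd ℂ) α * f z)
  have hgd : DifferentiableOn ℂ g (ball (0 : ℂ) 1) :=
    (hd.sub_const α).div ((hd.const_mul _).const_sub 1) hden
  have hg1 : ∀ z ∈ ball (0 : ℂ) 1, ‖g z‖ ≤ 1 := by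
    intro z hz
    simp only [g, norm_div]
    exact div_le_one_of_le₀ (mobius_norm h1.le (hb z hz)) (norm_nonneg _)
  have hgps := isPS_of_diff hgd
  set b := taylorCoeff g with hbdef
  have hb0 : b 0 = 0 := by
    rw [hbdef, taylorCoeff_zero]; simp [g, hf0]
  have hconst : ∀ (e : ℂ), IsPS (fun k => if k = 0 then e else 0) (fun _ => e) := by
    intro e z hz
    have := hasSum_ite_eq (0 : ℕ) e
    refine this.congr_fun ?_
    intro k
    by_cases hk : k = 0 <;> simp [hk]
  let u : ℕ → ℂ := fun k => (if k = 0 then 1 else 0) - (starRingEnd ℂ) α * a k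
  have hu : IsPS u (fun z => 1 - (starRingEnd ℂ) α * f z) := by
    intro z hz
    have := (hconst 1 z hz).sub ((hps z hz).mul_left ((starRingEnd ℂ) α))
    refine this.congr_fun ?_
    intro k
    simp only [u]; ring
  let e : ℕ → ℂ := fun k => a k - (if k = 0 then α else 0)
  have he : IsPS e (fun z => f z - α) := by
    intro z hz
    have := (hps z hz).sub (hconst α z hz)
    refine this.congr_fun ?_
    intro k
    simp only [e]; ring
  have he' : IsPS (fun n => ∑ kl ∈ Finset.HasAntidiagonal.antidiagonal n, b kl.1 * u kl.2)
      (fun z => f z - α) := by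
    intro z hz
    have h := hgps.mul hu z hz
    have hz' : z ∈ ball (0 : ℂ) 1 := by simpa using hz
    have : g z * (1 - (starRingEnd ℂ) α * f z) = f z - α := div_mul_cancel₀ _ (hden z hz')
    simp only [this] at h
    exact h
  have hee := he.unique he'
  let q : ℕ → ℂ := fun k => if k < m + 1 then u k else 0
  have hq : IsPS q (fun z => ∑ j ∈ Finset.range (m + 1), u j * z ^ j) := by
    intro z hz
    have h : HasSum (fun k => q k * z ^ k) (∑ j ∈ Finset.range (m + 1), q j * z ^ j) := by
      apply hasSum_sum_of_ne_finset_zero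
      intro k hk
      have : ¬ k < m + 1 := by simpa using hk
      simp only [q, if_neg this, zero_mul]
    have h2 : ∑ j ∈ Finset.range (m + 1), q j * z ^ j =
        ∑ j ∈ Finset.range (m + 1), u j * z ^ j := by
      refine Finset.sum_congr rfl fun j hj => ?_
      simp only [q, if_pos (Finset.mem_range.mp hj)]
    rw [h2] at h
    exact h
  have hL := L2_bound (q := u) (m + 1) (m + 2) (hgps.mul hq) (by
    intro z hz
    rw [norm_mul]
    have := hg1 z (by simpa using hz)
    exact mul_le_of_le_one_left (norm_nonneg _) this)
  have hde : ∀ k ∈ Finset.range (m + 2),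
      ‖∑ kl ∈ Finset.HasAntidiagonal.antidiagonal k, b kl.1 * q kl.2‖ ^ 2 = ‖e k‖ ^ 2 := by
    intro k hk
    rw [hee]
    congr 2
    refine Finset.sum_congr rfl fun kl hkl => ?_
    have h3 := Finset.HasAntidiagonal.mem_antidiagonal.mp hkl
    have h4 := Finset.mem_range.mp hk
    by_cases h5 : kl.1 = 0
    · simp [h5, hb0]
    · have : kl.2 < m + 1 := by omega
      simp only [q, if_pos this]
  rw [Finset.sum_congr rfl hde, Finset.sum_range_succ',
    Finset.sum_range_succ' (fun k => ‖u k‖ ^ 2) m] at hL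
  have e0 : e 0 = 0 := by simp [e, hα]
  have ek : ∀ k, e (k + 1) = a (k + 1) := by intro k; simp [e]
  have uk : ∀ k, ‖u (k + 1)‖ ^ 2 = ‖α‖ ^ 2 * ‖a (k + 1)‖ ^ 2 := by
    intro k; simp [u, mul_pow]
  have u0 : ‖u 0‖ ^ 2 = (1 - ‖α‖ ^ 2) ^ 2 := by
    have : u 0 = ((1 - ‖α‖ ^ 2 : ℝ) : ℂ) := by
      simp only [u, if_true]
      rw [← hα, RCLike.conj_mul]
      push_cast; rfl
    rw [this, Complex.norm_real, Real.norm_eq_abs, sq_abs]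
  simp only [e0, ek, uk, u0] at hL
  rw [← Finset.mul_sum] at hL
  simp at hL
  linarith

lemma norm_coeff_zero_le {f : ℂ → ℂ} (hf : memB f) : ‖taylorCoeff f 0‖ ≤ 1 := by
  rw [taylorCoeff_zero]; exact hf.2 0 (by simp)

lemma coeff_psum {f : ℂ → ℂ} (hf : memB f) (n : ℕ) :
    ∑ k ∈ Finset.range n, ‖taylorCoeff f (k + 1)‖ ^ 2 ≤
      ∑ k ∈ Finset.range n, (1 - ‖taylorCoeff f 0‖ ^ 2) ^ 2 * (‖taylorCoeff f 0‖ ^ 2) ^ k := by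
  rcases (norm_coeff_zero_le hf).lt_or_eq with h1 | h1
  · induction n with
    | zero => simp
    | succ m ih =>
      refine (coeff_rec hf h1 m).trans ?_
      rw [Finset.sum_range_succ' _ m]
      have := mul_le_mul_of_nonneg_left ih (sq_nonneg ‖taylorCoeff f 0‖)
      rw [Finset.mul_sum (f := fun k => (1 - ‖taylorCoeff f 0‖ ^ 2) ^ 2 *
        (‖taylorCoeff f 0‖ ^ 2) ^ k)] at this
      have h2 : ∑ k ∈ Finset.range m, ‖taylorCoeff f 0‖ ^ 2 * ((1 - ‖taylorCoeff f 0‖ ^ 2) ^ 2 *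
        (‖taylorCoeff f 0‖ ^ 2) ^ k) = ∑ k ∈ Finset.range m, (1 - ‖taylorCoeff f 0‖ ^ 2) ^ 2 *
        (‖taylorCoeff f 0‖ ^ 2) ^ (k + 1) :=
        Finset.sum_congr rfl fun k _ => by ring
      rw [h2] at this
      simp only [pow_zero, mul_one]
      linarith
  · have hL := L2_bound (q := fun _ => 1) 1 (n + 1) (isPS_of_diff hf.1) (by
      intro z hz
      simpa using hf.2 z (by simpa using hz))
    rw [Finset.sum_range_succ', h1] at hL
    simp at hL
    rw [h1]
    simpa using hL

lemma abel_aux (w d : ℕ → ℝ) (hw : Antitone w) (hD : ∀ n, 0 ≤ ∑ k ∈ Finset.range n, d k)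
    (n : ℕ) : w n * ∑ k ∈ Finset.range (n + 1), d k ≤ ∑ k ∈ Finset.range (n + 1), w k * d k := by
  induction n with
  | zero => simp
  | succ n ih =>
    rw [Finset.sum_range_succ, Finset.sum_range_succ (fun k => w k * d k)]
    have := mul_le_mul_of_nonneg_right (hw (Nat.le_succ n)) (hD (n + 1))
    simp only [Nat.succ_eq_add_one] at this
    nlinarith

lemma coeff_weighted {f : ℂ → ℂ} (hf : memB f) (w : ℕ → ℝ) (hw : Antitone w)
    (hw0 : ∀ n, 0 ≤ w n) (n : ℕ) :
    ∑ k ∈ Finset.range n, w k * ‖taylorCoeff f (k + 1)‖ ^ 2 ≤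
      (1 - ‖taylorCoeff f 0‖ ^ 2) ^ 2 *
        ∑ k ∈ Finset.range n, w k * (‖taylorCoeff f 0‖ ^ 2) ^ k := by
  cases n with
  | zero => simp
  | succ n =>
    have hD : ∀ n, 0 ≤ ∑ k ∈ Finset.range n, ((1 - ‖taylorCoeff f 0‖ ^ 2) ^ 2 *
        (‖taylorCoeff f 0‖ ^ 2) ^ k - ‖taylorCoeff f (k + 1)‖ ^ 2) := by
      intro n
      rw [Finset.sum_sub_distrib]
      linarith [coeff_psum hf n]
    have h := abel_aux w _ hw hD n
    have h2 := (mul_nonneg (hw0 n) (hD (n + 1))).trans h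
    simp only [mul_sub] at h2
    rw [Finset.sum_sub_distrib] at h2
    rw [Finset.mul_sum]
    have h3 : ∑ k ∈ Finset.range (n + 1), (1 - ‖taylorCoeff f 0‖ ^ 2) ^ 2 *
        (w k * (‖taylorCoeff f 0‖ ^ 2) ^ k) = ∑ k ∈ Finset.range (n + 1), w k *
        ((1 - ‖taylorCoeff f 0‖ ^ 2) ^ 2 * (‖taylorCoeff f 0‖ ^ 2) ^ k) :=
      Finset.sum_congr rfl fun k _ => by ring
    rw [h3]
    linarith

lemma geomN {y : ℝ} (h0 : 0 ≤ y) (h1 : y < 1) (N : ℕ) :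
    ∑ k ∈ Finset.range N, y ^ k ≤ (1 - y)⁻¹ :=
  sum_le_hasSum _ (fun _ _ => by positivity) (hasSum_geometric_of_lt_one h0 h1)

lemma hasSum_succ_geom {y : ℝ} (h0 : 0 ≤ y) (h1 : y < 1) :
    HasSum (fun k : ℕ => ((k : ℝ) + 1) * y ^ k) (1 / (1 - y) ^ 2) := by
  have h := (hasSum_coe_mul_geometric_of_norm_lt_one (r := y)
    (by rwa [Real.norm_of_nonneg h0])).add (hasSum_geometric_of_lt_one h0 h1)
  have h2 : 1 - y ≠ 0 := by linarith
  convert! h using 1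
  · funext k; ring
  · field_simp; ring

lemma area_le {f : ℂ → ℂ} (hf : memB f) {r : ℝ} (h0 : 0 ≤ r) (h1 : r ≤ 1 / 3) :
    ∑' n : ℕ, (n : ℝ) * ‖taylorCoeff f n‖ ^ 2 * r ^ (2 * n) ≤
      (1 - ‖taylorCoeff f 0‖ ^ 2) ^ 2 * (r ^ 2 / (1 - ‖taylorCoeff f 0‖ ^ 2 * r ^ 2) ^ 2) := by
  have ha := norm_coeff_zero_le hf
  set a := ‖taylorCoeff f 0‖ with hadef
  have ha0 : 0 ≤ a := norm_nonneg _
  have hr2 : r ^ 2 ≤ 1 / 9 := by nlinarith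
  have ha2 : a ^ 2 ≤ 1 := by nlinarith
  have hy0 : 0 ≤ a ^ 2 * r ^ 2 := by positivity
  have hy1 : a ^ 2 * r ^ 2 < 1 := by nlinarith [sq_nonneg r]
  have hanti : Antitone (fun k : ℕ => ((k : ℝ) + 1) * r ^ (2 * (k + 1))) := by
    apply antitone_nat_of_succ_le
    intro k
    have : r ^ (2 * (k + 1 + 1)) = r ^ (2 * (k + 1)) * r ^ 2 := by ring
    rw [this]
    push_cast
    have hp : 0 ≤ r ^ (2 * (k + 1)) := by positivity
    have hk : (0 : ℝ) ≤ k := Nat.cast_nonneg k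
    have : ((k : ℝ) + 1 + 1) * r ^ 2 ≤ k + 1 := by nlinarith
    nlinarith
  refine Real.tsum_le_of_sum_range_le (fun n => by positivity) ?_
  intro N
  have hpos : 0 ≤ (1 - a ^ 2) ^ 2 * (r ^ 2 / (1 - a ^ 2 * r ^ 2) ^ 2) := by positivity
  cases N with
  | zero => simpa using hpos
  | succ N =>
    rw [Finset.sum_range_succ']
    simp only [Nat.cast_zero, zero_mul, add_zero]
    have hw := coeff_weighted hf _ hanti (fun n => by positivity) N
    rw [← hadef] at hw
    have e1 : ∑ k ∈ Finset.range N, ((k + 1 : ℕ) : ℝ) * ‖taylorCoeff f (k + 1)‖ ^ 2 *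
        r ^ (2 * (k + 1)) = ∑ k ∈ Finset.range N, ((k : ℝ) + 1) * r ^ (2 * (k + 1)) *
        ‖taylorCoeff f (k + 1)‖ ^ 2 :=
      Finset.sum_congr rfl fun k _ => by push_cast; ring
    rw [e1]
    refine hw.trans (mul_le_mul_of_nonneg_left ?_ (sq_nonneg _))
    have e2 : ∑ k ∈ Finset.range N, ((k : ℝ) + 1) * r ^ (2 * (k + 1)) * (a ^ 2) ^ k =
        r ^ 2 * ∑ k ∈ Finset.range N, ((k : ℝ) + 1) * (a ^ 2 * r ^ 2) ^ k := by
      rw [Finset.mul_sum]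
      exact Finset.sum_congr rfl fun k _ => by rw [mul_pow, pow_mul, pow_succ]; ring
    rw [e2, div_eq_mul_one_div]
    exact mul_le_mul_of_nonneg_left (sum_le_hasSum _ (fun _ _ => by positivity)
      (hasSum_succ_geom hy0 hy1)) (sq_nonneg r)

lemma bohr_le {f : ℂ → ℂ} (hf : memB f) {r ρ τ B : ℝ} (h0 : 0 ≤ r) (hρ0 : 0 ≤ ρ) (hρ1 : ρ ≤ 1)
    (hτ0 : 0 ≤ τ) (hτ1 : τ < 1) (hρτ : ρ * τ = r ^ 2) (hB : 0 ≤ B)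
    (haρ : ‖taylorCoeff f 0‖ ^ 2 * ρ < 1)
    (hBB : r ^ 2 * (1 - ‖taylorCoeff f 0‖ ^ 2) ^ 2 ≤
      B ^ 2 * ((1 - ‖taylorCoeff f 0‖ ^ 2 * ρ) * (1 - τ))) :
    bohrSum f r ≤ ‖taylorCoeff f 0‖ + B := by
  unfold bohrSum
  set a := ‖taylorCoeff f 0‖ with hadef
  have ha0 : 0 ≤ a := norm_nonneg _
  refine Real.tsum_le_of_sum_range_le (fun n => by positivity) ?_
  intro N
  cases N with
  | zero => simp; positivity
  | succ N =>
    rw [Finset.sum_range_succ']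
    simp only [pow_zero, mul_one]
    rw [← hadef, add_comm]
    gcongr
    have hanti : Antitone (fun k : ℕ => ρ ^ k) := pow_right_anti₀ hρ0 hρ1
    have hw := coeff_weighted hf _ hanti (fun n => by positivity) N
    rw [← hadef] at hw
    have hcs := Finset.sum_sq_le_sum_mul_sum_of_sq_le_mul (Finset.range N)
      (r := fun k => ‖taylorCoeff f (k + 1)‖ * r ^ k)
      (f := fun k => ρ ^ k * ‖taylorCoeff f (k + 1)‖ ^ 2) (g := fun k => τ ^ k)
      (fun _ _ => by positivity) (fun _ _ => by positivity)
      (fun k _ => le_of_eq <| by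
        have : ρ ^ k * τ ^ k = (r ^ k) ^ 2 := by rw [← mul_pow, hρτ]; ring
        rw [mul_pow, ← this]; ring)
    have g1 := geomN hτ0 hτ1 N
    have g2 := geomN (y := a ^ 2 * ρ) (by positivity) haρ N
    have e2 : ∑ k ∈ Finset.range N, ρ ^ k * (a ^ 2) ^ k =
        ∑ k ∈ Finset.range N, (a ^ 2 * ρ) ^ k :=
      Finset.sum_congr rfl fun k _ => by rw [mul_pow]; ring
    rw [e2] at hw
    have hw2 := hw.trans (mul_le_mul_of_nonneg_left g2 (sq_nonneg _))
    have hτ' : 0 < 1 - τ := by linarith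
    have ha' : 0 < 1 - a ^ 2 * ρ := by linarith
    have hcs2 := hcs.trans (mul_le_mul hw2 g1 (Finset.sum_nonneg fun _ _ => by positivity)
      (by positivity))
    have e3 : ∑ k ∈ Finset.range N, ‖taylorCoeff f (k + 1)‖ * r ^ (k + 1) =
        r * ∑ k ∈ Finset.range N, ‖taylorCoeff f (k + 1)‖ * r ^ k := by
      rw [Finset.mul_sum]
      exact Finset.sum_congr rfl fun k _ => by ring
    rw [e3]
    refine le_of_sq_le_sq ?_ hB
    rw [mul_pow]
    refine (mul_le_mul_of_nonneg_left hcs2 (sq_nonneg r)).trans ?_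
    have : r ^ 2 * ((1 - a ^ 2) ^ 2 * (1 - a ^ 2 * ρ)⁻¹ * (1 - τ)⁻¹) =
        (r ^ 2 * (1 - a ^ 2) ^ 2) / ((1 - a ^ 2 * ρ) * (1 - τ)) := by
      field_simp
    rw [this, div_le_iff₀ (by positivity)]
    exact hBB

/-- The expression whose infimum is `LamExpr R`. -/
noncomputable def EE (a R : ℝ) : ℝ :=
  (1 - R ^ 2) / R ^ 2 * ((1 - a ^ 4 * R ^ 2) / ((1 - a) * (1 + a) ^ 2)) *
      ((1 - R * (1 + 2 * a)) / (1 - a * R))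

lemma EE_nonneg {a R : ℝ} (ha0 : 0 ≤ a) (ha1 : a < 1) (hR0 : 0 < R) (hR : R ≤ 1 / 3) :
    0 ≤ EE a R := by
  unfold EE
  have h1 : 0 ≤ 1 - R ^ 2 := by nlinarith
  have h2 : 0 ≤ 1 - a ^ 4 * R ^ 2 := by
    have : a ^ 4 ≤ 1 := pow_le_one₀ ha0 ha1.le
    nlinarith [sq_nonneg R]
  have h3 : 0 < 1 - a := by linarith
  have h4 : 0 ≤ 1 - R * (1 + 2 * a) := by nlinarith
  have h5 : 0 < 1 - a * R := by nlinarith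
  positivity

lemma EE_anti {a r R : ℝ} (ha0 : 0 ≤ a) (ha1 : a < 1) (hr : 0 < r) (hrR : r ≤ R)
    (hR : R ≤ 1 / 3) : EE a R ≤ EE a r := by
  unfold EE
  have hR0 : 0 < R := by linarith
  have h1 : 0 ≤ 1 - R ^ 2 := by nlinarith
  have h4' : a ^ 4 ≤ 1 := pow_le_one₀ ha0 ha1.le
  have h40 : 0 ≤ a ^ 4 := by positivity
  have h2 : 0 ≤ 1 - a ^ 4 * R ^ 2 := by
    nlinarith [sq_nonneg R]
  have h3 : 0 < 1 - a := by linarith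
  have h4 : 0 ≤ 1 - R * (1 + 2 * a) := by nlinarith
  have h5 : 0 < 1 - a * R := by nlinarith
  have h5' : 0 < 1 - a * r := by nlinarith
  have hsq : r ^ 2 ≤ R ^ 2 := by gcongr
  have i1 : (1 - R ^ 2) / R ^ 2 ≤ (1 - r ^ 2) / r ^ 2 := by
    apply div_le_div₀ <;> first | positivity | linarith
  have i2 : (1 - a ^ 4 * R ^ 2) / ((1 - a) * (1 + a) ^ 2) ≤
      (1 - a ^ 4 * r ^ 2) / ((1 - a) * (1 + a) ^ 2) := by
    gcongr
  have i3 : (1 - R * (1 + 2 * a)) / (1 - a * R) ≤ (1 - r * (1 + 2 * a)) / (1 - a * r) := by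
    rw [div_le_div_iff₀ h5 h5']
    nlinarith
  have j3 : 0 ≤ (1 - R * (1 + 2 * a)) / (1 - a * R) := by positivity
  have j2 : 0 ≤ (1 - a ^ 4 * R ^ 2) / ((1 - a) * (1 + a) ^ 2) := by positivity
  have j1 : 0 ≤ (1 - R ^ 2) / R ^ 2 := by positivity
  exact mul_le_mul (mul_le_mul i1 i2 j2 (j1.trans i1)) i3 j3
    (mul_nonneg (j1.trans i1) (j2.trans i2))

lemma LamExpr_eq (R : ℝ) : LamExpr R = sInf {x : ℝ | ∃ a : ℝ, 0 ≤ a ∧ a < 1 ∧ x = EE a R} := rfl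

lemma Lam_nonneg {R : ℝ} (hR0 : 0 < R) (hR : R ≤ 1 / 3) : 0 ≤ LamExpr R := by
  rw [LamExpr_eq]
  apply Real.sInf_nonneg
  rintro x ⟨a, h0, h1, rfl⟩
  exact EE_nonneg h0 h1 hR0 hR

lemma Lam_le {a r R : ℝ} (ha0 : 0 ≤ a) (ha1 : a < 1) (hr : 0 < r) (hrR : r ≤ R)
    (hR : R ≤ 1 / 3) : LamExpr R ≤ EE a r := by
  refine le_trans ?_ (EE_anti ha0 ha1 hr hrR hR)
  rw [LamExpr_eq]
  refine csInf_le ⟨0, ?_⟩ ⟨a, ha0, ha1, rfl⟩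
  rintro x ⟨b, h0, h1, rfl⟩
  exact EE_nonneg h0 h1 (by linarith) hR

lemma phi0_eq (f : ℂ → ℂ) (r : ℝ) : phi0 f r =
    (∑' n : ℕ, (n : ℝ) * ‖taylorCoeff f n‖ ^ 2 * r ^ (2 * n)) /
      (1 - ∑' n : ℕ, (n : ℝ) * ‖taylorCoeff f n‖ ^ 2 * r ^ (2 * n)) := by
  unfold phi0 Sarea
  set s := ∑' n : ℕ, (n : ℝ) * ‖taylorCoeff f n‖ ^ 2 * r ^ (2 * n)
  have : Real.pi - Real.pi * s = Real.pi * (1 - s) := by ring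
  rw [this, mul_div_mul_left _ _ Real.pi_ne_zero]

/-- `M / (1 - M)` for the Möbius value `M` of the normalized area. -/
lemma mobius_area {a r : ℝ} (ha0 : 0 ≤ a) (ha1 : a ≤ 1) (hr : 0 ≤ r) (hr1 : r ≤ 1 / 3) :
    (1 - a ^ 2) ^ 2 * (r ^ 2 / (1 - a ^ 2 * r ^ 2) ^ 2) < 1 ∧
    (1 - a ^ 2) ^ 2 * (r ^ 2 / (1 - a ^ 2 * r ^ 2) ^ 2) /
      (1 - (1 - a ^ 2) ^ 2 * (r ^ 2 / (1 - a ^ 2 * r ^ 2) ^ 2)) =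
      (1 - a ^ 2) ^ 2 * r ^ 2 / ((1 - r ^ 2) * (1 - a ^ 4 * r ^ 2)) := by
  have h1 : 0 < 1 - r ^ 2 := by nlinarith
  have h4' : a ^ 4 ≤ 1 := pow_le_one₀ ha0 ha1
  have h2' : a ^ 2 ≤ 1 := pow_le_one₀ ha0 ha1
  have h2 : 0 < 1 - a ^ 4 * r ^ 2 := by nlinarith [sq_nonneg r]
  have h3 : 0 < 1 - a ^ 2 * r ^ 2 := by nlinarith [sq_nonneg r]
  have key : (1 - a ^ 2 * r ^ 2) ^ 2 - (1 - a ^ 2) ^ 2 * r ^ 2 =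
      (1 - r ^ 2) * (1 - a ^ 4 * r ^ 2) := by ring
  have hM : 1 - (1 - a ^ 2) ^ 2 * (r ^ 2 / (1 - a ^ 2 * r ^ 2) ^ 2) =
      ((1 - r ^ 2) * (1 - a ^ 4 * r ^ 2)) / (1 - a ^ 2 * r ^ 2) ^ 2 := by
    rw [← key]; field_simp
  constructor
  · have : 0 < ((1 - r ^ 2) * (1 - a ^ 4 * r ^ 2)) / (1 - a ^ 2 * r ^ 2) ^ 2 := by positivity
    linarith
  · rw [hM, ← mul_div_assoc, div_div_div_cancel_right₀ (by positivity)]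

lemma phi0_le {f : ℂ → ℂ} (hf : memB f) {r : ℝ} (h0 : 0 ≤ r) (h1 : r ≤ 1 / 3) :
    phi0 f r ≤ (1 - ‖taylorCoeff f 0‖ ^ 2) ^ 2 * r ^ 2 /
      ((1 - r ^ 2) * (1 - ‖taylorCoeff f 0‖ ^ 4 * r ^ 2)) := by
  obtain ⟨hM, hE⟩ := mobius_area (norm_nonneg _) (norm_coeff_zero_le hf) h0 h1
  rw [phi0_eq, ← hE]
  have := area_le hf h0 h1
  have h3 : 0 ≤ ∑' n : ℕ, (n : ℝ) * ‖taylorCoeff f n‖ ^ 2 * r ^ (2 * n) :=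
    tsum_nonneg fun n => by positivity
  apply div_le_div₀ <;> linarith

set_option maxHeartbeats 1000000 in
/-- Numerical estimate used when `|a₀| < r`. -/
lemma small_case {a r : ℝ} (ha0 : 0 ≤ a) (har : a < r) (hr : r ≤ 1 / 3) :
    a + r / 2 * (1 + (1 - a ^ 2) / (1 - r ^ 2)) +
      EE (1 / 2) r * ((1 - a ^ 2) ^ 2 * r ^ 2 / ((1 - r ^ 2) * (1 - a ^ 4 * r ^ 2))) ≤ 1 := by
  have hr0 : 0 < r := by linarith
  have h1 : 0 < 1 - r ^ 2 := by nlinarith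
  have hr9 : r ^ 2 ≤ 1 / 9 := by nlinarith
  have ha9 : a ^ 2 ≤ 1 / 9 := by nlinarith
  have ha4 : a ^ 4 ≤ a ^ 2 / 9 := by nlinarith [sq_nonneg a]
  have ha40 : 0 ≤ a ^ 4 := by positivity
  have h2 : 0 < 1 - a ^ 4 * r ^ 2 := by nlinarith [sq_nonneg r]
  have h3 : 0 < 1 - 1 / 2 * r := by linarith
  set X := 8 / 9 * ((1 - 2 * r) / (1 - 1 / 2 * r)) with hX
  have hX0 : 0 ≤ X := by
    have : 0 ≤ 1 - 2 * r := by linarith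
    positivity
  have hXe : X * (1 - r / 2) = 8 / 9 * (1 - 2 * r) := by
    rw [hX, show 1 - r / 2 = 1 - 1 / 2 * r by ring, mul_assoc, div_mul_cancel₀ _ h3.ne']
  have e1 : EE (1 / 2) r * ((1 - a ^ 2) ^ 2 * r ^ 2 / ((1 - r ^ 2) * (1 - a ^ 4 * r ^ 2))) =
      X * (1 - r ^ 2 / 16) * ((1 - a ^ 2) ^ 2 / (1 - a ^ 4 * r ^ 2)) := by
    rw [hX]; unfold EE
    field_simp
    ring
  rw [e1]
  have e2 : (1 - a ^ 2) ^ 2 / (1 - a ^ 4 * r ^ 2) ≤ 1 - 9 / 5 * a ^ 2 := by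
    rw [div_le_iff₀ h2]
    have : a ^ 4 * r ^ 2 ≤ a ^ 2 / 81 := by nlinarith
    nlinarith [mul_nonneg ha40 (sq_nonneg r), mul_nonneg (sq_nonneg a) (mul_nonneg ha40 (sq_nonneg r))]
  have e3 : X * (1 - r ^ 2 / 16) * ((1 - a ^ 2) ^ 2 / (1 - a ^ 4 * r ^ 2)) ≤
      X * (1 - 9 / 5 * a ^ 2) := by
    have : X * (1 - r ^ 2 / 16) ≤ X := by nlinarith [sq_nonneg r]
    exact mul_le_mul this e2 (by positivity) hX0
  have e4 : (1 - a ^ 2) / (1 - r ^ 2) ≤ 1 + 9 / 8 * (r ^ 2 - a ^ 2) := by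
    rw [div_le_iff₀ h1]
    have : 0 ≤ r ^ 2 - a ^ 2 := by nlinarith
    nlinarith
  have e5 : r / 2 * (1 + (1 - a ^ 2) / (1 - r ^ 2)) ≤ r / 2 * (2 + 9 / 8 * (r ^ 2 - a ^ 2)) := by
    apply mul_le_mul_of_nonneg_left _ (by linarith)
    linarith
  -- value at a = r
  have e6 : 2 * r + X * (1 - 9 / 5 * r ^ 2) ≤ 1 := by
    have : 0 ≤ (1 - 2 * r) * (1 / 9 - r / 2 + 8 / 5 * r ^ 2) := by
      apply mul_nonneg (by linarith)
      nlinarith [sq_nonneg (r - 5 / 32)]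
    have h7 : (2 * r + X * (1 - 9 / 5 * r ^ 2)) * (1 - r / 2) ≤ 1 * (1 - r / 2) := by
      have : (2 * r + X * (1 - 9 / 5 * r ^ 2)) * (1 - r / 2) =
        2 * r * (1 - r / 2) + (X * (1 - r / 2)) * (1 - 9 / 5 * r ^ 2) := by ring
      rw [this, hXe]
      nlinarith
    exact le_of_mul_le_mul_right h7 (by linarith)
  have hXr : X * r ≤ 2 / 15 := by
    have h8 : X * r * (1 - r / 2) = 8 / 9 * ((1 - 2 * r) * r) := by
      rw [mul_right_comm, hXe]; ring
    have h9 : (1 - 2 * r) * r ≤ 1 / 8 := by nlinarith [sq_nonneg (r - 1 / 4)]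
    have : X * r * (5 / 6) ≤ X * r * (1 - r / 2) :=
      mul_le_mul_of_nonneg_left (by linarith) (by positivity)
    nlinarith
  have e7 : 0 ≤ (r - a) * (1 - r / 2 * (9 / 8) * (a + r) - 9 / 5 * X * (a + r)) := by
    apply mul_nonneg (by linarith)
    have : X * a ≤ X * r := mul_le_mul_of_nonneg_left har.le hX0
    have h10 : r * (a + r) ≤ 2 / 9 :=
      (mul_le_mul hr (show a + r ≤ 2 / 3 by linarith) (by linarith) (by norm_num)).trans
        (by norm_num)
    linarith
  linarith

lemma main_ineq {R : ℝ} (hR0 : 0 < R) (hR : R ≤ 1 / 3) {f : ℂ → ℂ} (hf : memB f) {r : ℝ}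
    (hr0 : 0 ≤ r) (hrR : r ≤ R) : bohrSum f r + LamExpr R * phi0 f r ≤ 1 := by
  have hr3 : r ≤ 1 / 3 := hrR.trans hR
  have hphi := phi0_le hf hr0 hr3
  have hLam := Lam_nonneg hR0 hR
  have ha1 := norm_coeff_zero_le hf
  have hmul := mul_le_mul_of_nonneg_left hphi hLam
  have hb := @bohr_le f hf r
  set a := ‖taylorCoeff f 0‖ with hadef
  have ha0 : 0 ≤ a := norm_nonneg _
  have h1 : 0 < 1 - r ^ 2 := by nlinarith
  have ha2 : a ^ 2 ≤ 1 := pow_le_one₀ ha0 ha1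
  have ha4 : a ^ 4 ≤ 1 := pow_le_one₀ ha0 ha1
  have h2 : 0 < 1 - a ^ 4 * r ^ 2 := by nlinarith [sq_nonneg r]
  rcases ha1.eq_or_lt with h | hlt
  · rw [h] at hmul hb
    have := hb (ρ := r) (τ := r) (B := 0) hr0 hr0 (by linarith) hr0 (by linarith) (by ring) le_rfl
      (by linarith) (by simp)
    norm_num at hmul
    linarith
  rcases hr0.eq_or_lt with h | hrpos
  · subst h
    have := hb (ρ := 0) (τ := 0) (B := 0) le_rfl le_rfl (by linarith) le_rfl (by linarith)
      (by ring) le_rfl (by linarith) (by simp)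
    norm_num at hmul
    linarith
  have hpn : 0 ≤ (1 - a ^ 2) ^ 2 * r ^ 2 / ((1 - r ^ 2) * (1 - a ^ 4 * r ^ 2)) := by positivity
  rcases le_or_gt r a with hra | har
  · have hapos : 0 < a := by linarith
    have h5 : 0 < 1 - a * r := by nlinarith
    have hB := hb (ρ := r / a) (τ := r * a) (B := r * (1 - a ^ 2) / (1 - a * r)) hr0
      (by positivity) (by rwa [div_le_one hapos]) (by positivity) (by nlinarith)
      (by field_simp) (div_nonneg (mul_nonneg hr0 (by linarith)) h5.le)
      (by
        have : a ^ 2 * (r / a) = a * r := by field_simp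
        rw [this]; linarith)
      (by
        have : a ^ 2 * (r / a) = a * r := by field_simp
        rw [this, mul_comm r a, ← sq, ← mul_pow, ← mul_pow, div_mul_cancel₀ _ h5.ne'])
    have hL := mul_le_mul_of_nonneg_right (Lam_le ha0 hlt hrpos hrR hR) hpn
    have h3 : 1 - a ≠ 0 := by linarith
    have : a + r * (1 - a ^ 2) / (1 - a * r) + EE a r *
        ((1 - a ^ 2) ^ 2 * r ^ 2 / ((1 - r ^ 2) * (1 - a ^ 4 * r ^ 2))) = 1 := by
      unfold EE
      field_simp
      ring
    linarith
  · have hB := hb (ρ := 1) (τ := r ^ 2) (B := r / 2 * (1 + (1 - a ^ 2) / (1 - r ^ 2))) hr0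
      (by norm_num) le_rfl (by positivity) (by linarith) (by ring)
      (by
        have : 0 ≤ 1 - a ^ 2 := by linarith
        positivity)
      (by nlinarith)
      (by
        have hA : 0 ≤ 1 - a ^ 2 := by linarith
        obtain ⟨t, ht⟩ : ∃ t, t = (1 - a ^ 2) / (1 - r ^ 2) := ⟨_, rfl⟩
        have ht' : 1 - a ^ 2 = t * (1 - r ^ 2) := by rw [ht]; field_simp
        rw [← ht, mul_one, ht']
        have ht0 : 0 ≤ t := by rw [ht]; positivity
        have h6 : 0 ≤ r ^ 2 * t * (1 - r ^ 2) ^ 2 * (1 - t) ^ 2 := by positivity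
        nlinarith)
    have hL := mul_le_mul_of_nonneg_right
      (Lam_le (a := 1 / 2) (by norm_num) (by norm_num) hrpos hrR hR) hpn
    have := small_case ha0 har hr3
    linarith

lemma sharp {R : ℝ} (hR0 : 0 < R) (hR : R ≤ 1 / 3) {lam : ℝ} (hl : LamExpr R < lam) :
    ∃ f, memB f ∧ ∃ r, 0 ≤ r ∧ r ≤ R ∧ 1 < bohrSum f r + lam * phi0 f r := by
  rw [LamExpr_eq] at hl
  obtain ⟨x, ⟨a, ha0, ha1, rfl⟩, hx⟩ := exists_lt_of_csInf_lt (by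
    exact ⟨EE 0 R, 0, le_rfl, one_pos, rfl⟩) hl
  have han : ‖(a : ℂ)‖ = a := by rw [Complex.norm_real, Real.norm_of_nonneg ha0]
  have hden : ∀ z : ℂ, ‖z‖ < 1 → 1 - (a : ℂ) * z ≠ 0 := by
    intro z hz h
    have h2 : (a : ℂ) * z = 1 := (sub_eq_zero.mp h).symm
    have h3 : ‖(a : ℂ) * z‖ < 1 := by
      rw [norm_mul, han]; nlinarith [norm_nonneg z]
    rw [h2] at h3
    simp at h3
  let f : ℂ → ℂ := fun z => (z - a) / (1 - a * z)
  have hf : memB f := by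
    constructor
    · apply DifferentiableOn.div (by fun_prop) (by fun_prop)
      intro z hz
      exact hden z (by simpa using hz)
    · intro z hz
      simp only [f, norm_div]
      have := mobius_norm (α := (a : ℂ)) (w := z) (by rw [han]; exact ha1.le)
        (by simpa using (mem_ball.mp hz).le)
      rw [Complex.conj_ofReal] at this
      exact div_le_one_of_le₀ this (norm_nonneg _)
  let c : ℕ → ℂ := fun k => if k = 0 then -(a : ℂ) else (1 - (a : ℂ) ^ 2) * (a : ℂ) ^ (k - 1)
  have hc : IsPS c f := by
    intro z hz
    have hg := (hasSum_geometric_of_norm_lt_one (ξ := (a : ℂ) * z) (by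
      rw [norm_mul, han]; nlinarith [norm_nonneg z])).mul_left ((1 - (a : ℂ) ^ 2) * z)
    rw [← hasSum_nat_add_iff' 1]
    convert! hg using 1
    · funext k
      simp only [c, Nat.add_one_ne_zero, if_false, Nat.add_sub_cancel]
      ring
    · have := hden z hz
      simp only [Finset.sum_range_one, c, f, if_true, pow_zero, mul_one, sub_neg_eq_add]
      rw [div_add' _ _ _ this, ← div_eq_mul_inv]
      congr 1
      ring
  have hcf : taylorCoeff f = c := (isPS_of_diff hf.1).unique hc
  have hA : 0 ≤ 1 - a ^ 2 := by nlinarith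
  have c0 : ‖taylorCoeff f 0‖ = a := by rw [hcf]; simp [c, abs_of_nonneg ha0]
  have ck : ∀ k, ‖taylorCoeff f (k + 1)‖ = (1 - a ^ 2) * a ^ k := by
    intro k
    have : taylorCoeff f (k + 1) = (((1 - a ^ 2) * a ^ k : ℝ) : ℂ) := by
      rw [hcf]; simp [c]
    rw [this, Complex.norm_real, Real.norm_of_nonneg (by positivity)]
  have haR : a * R < 1 := by nlinarith
  have hb : bohrSum f R = a + R * (1 - a ^ 2) / (1 - a * R) := by
    unfold bohrSum
    refine HasSum.tsum_eq ?_
    rw [← hasSum_nat_add_iff' 1]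
    have := (hasSum_geometric_of_lt_one (r := a * R) (by positivity) haR).mul_left
      (R * (1 - a ^ 2))
    convert! this using 1
    · funext k
      rw [ck]; ring
    · simp [c0]; rw [div_eq_mul_inv]
  have hs : ∑' n : ℕ, (n : ℝ) * ‖taylorCoeff f n‖ ^ 2 * R ^ (2 * n) =
      (1 - a ^ 2) ^ 2 * (R ^ 2 / (1 - a ^ 2 * R ^ 2) ^ 2) := by
    refine HasSum.tsum_eq ?_
    rw [← hasSum_nat_add_iff' 1]
    have := (hasSum_succ_geom (y := a ^ 2 * R ^ 2) (by positivity) (by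
      rw [← mul_pow]; exact pow_lt_one₀ (by positivity) haR (by norm_num))).mul_left
      ((1 - a ^ 2) ^ 2 * R ^ 2)
    convert! this using 1
    · funext k
      rw [ck]; push_cast; ring
    · simp; ring
  have hM := (mobius_area ha0 ha1.le hR0.le hR).2
  refine ⟨f, hf, R, hR0.le, le_rfl, ?_⟩
  rw [phi0_eq, hs, hM, hb]
  have h1 : 0 < 1 - R ^ 2 := by nlinarith
  have ha4 : a ^ 4 ≤ 1 := pow_le_one₀ ha0 ha1.le
  have h2 : 0 < 1 - a ^ 4 * R ^ 2 := by nlinarith [sq_nonneg R]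
  have h5 : 0 < 1 - a * R := by linarith
  have h3 : 1 - a ≠ 0 := by linarith
  have hA' : 0 < 1 - a ^ 2 := by nlinarith
  have hpn : 0 < (1 - a ^ 2) ^ 2 * R ^ 2 / ((1 - R ^ 2) * (1 - a ^ 4 * R ^ 2)) := by positivity
  have hE : a + R * (1 - a ^ 2) / (1 - a * R) + EE a R *
      ((1 - a ^ 2) ^ 2 * R ^ 2 / ((1 - R ^ 2) * (1 - a ^ 4 * R ^ 2))) = 1 := by
    unfold EE
    field_simp
    ring
  have := mul_lt_mul_of_pos_right hx hpn
  linarith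

/-- For each `0 < R ≤ 1/3` the inequality
`Σ |aₙ| rⁿ + Λ(R) S_r/(π − S_r) ≤ 1` holds for every `f ∈ 𝓑` and `0 ≤ r ≤ R`, and the
constant `Λ(R)` is sharp: no larger constant works. -/
theorem bohr_with_sharp_constant (R : ℝ) (hR0 : 0 < R) (hR : R ≤ 1 / 3) :
    (∀ f, memB f → ∀ r, 0 ≤ r → r ≤ R →
      bohrSum f r + LamExpr R * phi0 f r ≤ 1) ∧
    (∀ lam : ℝ, LamExpr R < lam →
      ∃ f, memB f ∧ ∃ r, 0 ≤ r ∧ r ≤ R ∧ 1 < bohrSum f r + lam * phi0 f r) := by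
  exact ⟨fun f hf r h0 h1 => main_ineq hR0 hR hf h0 h1, fun lam hl => sharp hR0 hR hl⟩
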